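/- Let a, d, k be positive integers with gcd(a,d)=1 and 2 ≤ k ≤ a, and let μ ≥ 0 be an integer. Then s_μ(a, a+d, …, a+(k−1)d) = (1/(μ+1))·Σ_{κ=0}^{μ} Σ_{l=0}^{μ+1−κ} Σ_{j=0}^{l} C(μ+1,κ) C(μ+1−κ,l) C(l+1,j)·(B_κ B_j a^{μ−l} d^l/(l+1)) · ( (⌊(a−1)/(k−1)⌋+1)^{μ+1−κ−l} a^{l+1−j} − 1 − Σ_{i=1}^{⌊(a−1)/(k−1)⌋} ((i+1)^{μ+1−κ−l} − i^{μ+1−κ−l})·(i(k−1)+1)^{l+1−j} ) + (B_{μ+1}/(μ+1))·(a^{μ+1}−1). -/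

import Mathlib

open Finset

/-- `n` is representable as a nonnegative integer combination of the `a i`. -/
def Representable {k : ℕ} (a : Fin k → ℕ) (n : ℕ) : Prop :=
  ∃ x : Fin k → ℕ, n = ∑ i, x i * a i

/-- The set of positive integers that are not representable. -/
def NRset {k : ℕ} (a : Fin k → ℕ) : Set ℕ :=
  {n | 0 < n ∧ ¬ Representable a n}

/-- The **multiplication theorem** for Bernoulli polynomials at `0`:
`∑_{ρ < a} B_n(ρ / a) = a ^ (1 - n) B_n`. -/
theorem sum_bernoulli_eval_div (a : ℕ) (ha : 0 < a) (n : ℕ) :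
    (a : ℚ) ^ n * ∑ ρ ∈ range a, (Polynomial.bernoulli n).eval ((ρ : ℚ) / a) =
      a * bernoulli n := by
  have ha' : (a : ℚ) ≠ 0 := by positivity
  have hexp : PowerSeries.exp ℚ - 1 ≠ 0 := fun h => by
    simpa using congrArg (PowerSeries.coeff 1) h
  have hexpa : PowerSeries.exp ℚ ^ a - 1 ≠ 0 := fun h => by
    have := congrArg (PowerSeries.coeff 1) h
    rw [PowerSeries.exp_pow_eq_rescale_exp] at this
    simp [PowerSeries.coeff_rescale, PowerSeries.coeff_one, ha.ne'] at this
  have hgen (ρ : ℕ) :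
      PowerSeries.rescale (a : ℚ) (PowerSeries.mk fun n => Polynomial.aeval ((ρ : ℚ) / a)
        ((1 / n.factorial : ℚ) • Polynomial.bernoulli n)) * (PowerSeries.exp ℚ ^ a - 1) =
      (PowerSeries.C (a : ℚ) * PowerSeries.X) * PowerSeries.exp ℚ ^ ρ := by
    have := congrArg (PowerSeries.rescale (a : ℚ))
      (Polynomial.bernoulli_generating_function ((ρ : ℚ) / a))
    rw [map_mul, map_sub, map_one, map_mul, ← PowerSeries.exp_pow_eq_rescale_exp,
      PowerSeries.rescale_rescale, PowerSeries.rescale_X, div_mul_cancel₀ _ ha',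
      ← PowerSeries.exp_pow_eq_rescale_exp] at this
    exact this
  have hsum : ∑ ρ ∈ range a, PowerSeries.rescale (a : ℚ) (PowerSeries.mk fun n =>
      Polynomial.aeval ((ρ : ℚ) / a) ((1 / n.factorial : ℚ) • Polynomial.bernoulli n)) =
      PowerSeries.C (a : ℚ) * bernoulliPowerSeries ℚ := by
    apply mul_right_cancel₀ hexpa
    apply mul_right_cancel₀ hexp
    rw [sum_mul, sum_congr rfl fun ρ _ => hgen ρ, ← mul_sum, mul_assoc _ _ (PowerSeries.exp ℚ - 1),
      geom_sum_mul, ← bernoulliPowerSeries_mul_exp_sub_one ℚ]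
    ring
  have hcoeff := congrArg (PowerSeries.coeff n) hsum
  have hfac : (n.factorial : ℚ) ≠ 0 := by positivity
  simp only [map_sum, PowerSeries.coeff_rescale, PowerSeries.coeff_mk, map_smul,
    PowerSeries.coeff_C_mul, bernoulliPowerSeries, smul_eq_mul, Polynomial.coe_aeval_eq_eval,
    Algebra.algebraMap_self, RingHom.id_apply, ← mul_sum] at hcoeff
  field_simp at hcoeff
  exact hcoeff

/-- The value at `m` of the antidifference, with step `a`, of `x ^ μ`. -/
noncomputable def powerAntidifference (a μ m : ℕ) : ℚ :=
  (a : ℚ) ^ μ / (μ + 1) * (Polynomial.bernoulli (μ + 1)).eval ((m : ℚ) / a)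

theorem powerAntidifference_add (a : ℕ) (ha : 0 < a) (μ m : ℕ) :
    powerAntidifference a μ (m + a) = powerAntidifference a μ m + (m : ℚ) ^ μ := by
  have ha' : (a : ℚ) ≠ 0 := by positivity
  have h : ((m + a : ℕ) : ℚ) / a = 1 + m / a := by
    push_cast
    field_simp
    ring
  rw [powerAntidifference, powerAntidifference, h, Polynomial.bernoulli_eval_one_add,
    Nat.add_sub_cancel, div_pow]
  push_cast
  field_simp

theorem sum_filter_modEq_pow (a : ℕ) (ha : 0 < a) (μ m : ℕ) :
    ∑ n ∈ range m with n % a = m % a, (n : ℚ) ^ μ =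
      powerAntidifference a μ m - powerAntidifference a μ (m % a) := by
  induction m using Nat.strong_induction_on with
  | _ m ih =>
    rcases lt_or_ge m a with h | h
    · rw [Nat.mod_eq_of_lt h, sub_self, sum_eq_zero]
      intro n hn
      rw [mem_filter, mem_range] at hn
      rw [Nat.mod_eq_of_lt (hn.1.trans h)] at hn
      lia
    · obtain ⟨q, rfl⟩ := Nat.exists_eq_add_of_le' h
      have hset : {n ∈ range (q + a) | n % a = (q + a) % a} =
          insert q {n ∈ range q | n % a = q % a} := by
        ext n
        simp only [mem_filter, mem_range, mem_insert, Nat.add_mod_right]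
        constructor
        · rintro ⟨h1, h2⟩
          rcases lt_trichotomy n q with h3 | h3 | h3
          · exact Or.inr ⟨h3, h2⟩
          · exact Or.inl h3
          · have := Nat.le_of_dvd (by lia) ((Nat.modEq_iff_dvd' h3.le).1 h2.symm)
            lia
        · rintro (rfl | ⟨h1, h2⟩)
          · exact ⟨by lia, rfl⟩
          · exact ⟨by lia, h2⟩
      rw [hset, sum_insert (by simp), ih q (by lia), powerAntidifference_add a ha,
        Nat.add_mod_right]
      ring

theorem sum_powerAntidifference_range (a : ℕ) (ha : 0 < a) (μ : ℕ) :
    ∑ ρ ∈ range a, powerAntidifference a μ ρ = bernoulli (μ + 1) / (μ + 1) := by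
  have ha' : (a : ℚ) ≠ 0 := by positivity
  have h := sum_bernoulli_eval_div a ha (μ + 1)
  simp only [powerAntidifference, ← mul_sum]
  rw [pow_succ', mul_assoc] at h
  rw [div_mul_eq_mul_div, mul_left_cancel₀ ha' h]

theorem powerAntidifference_eq_sum (a : ℕ) (ha : 0 < a) (μ m : ℕ) :
    powerAntidifference a μ m =
      1 / ((μ : ℚ) + 1) * (∑ κ ∈ range (μ + 1), ((μ + 1).choose κ : ℚ) * bernoulli κ *
        (a : ℚ) ^ ((κ : ℤ) - 1) * (m : ℚ) ^ (μ + 1 - κ)) +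
      bernoulli (μ + 1) / (μ + 1) * (a : ℚ) ^ μ := by
  have ha' : (a : ℚ) ≠ 0 := by positivity
  rw [powerAntidifference, Polynomial.bernoulli, Polynomial.eval_finsetSum, sum_range_succ,
    mul_add, mul_sum, mul_sum]
  congr 1
  · refine sum_congr rfl fun κ hκ => ?_
    obtain ⟨e, rfl⟩ := Nat.exists_eq_add_of_le (Nat.lt_succ_iff.1 (mem_range.1 hκ))
    rw [Polynomial.eval_monomial, div_pow, show κ + e + 1 - κ = e + 1 by lia, zpow_sub_one₀ ha',
      zpow_natCast, pow_add]
    field_simp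
    ring
  · simp
    ring

/-- Numbers representable by `a, a + d, …, a + (k - 1) d` are the `t a + s d` with
`s ≤ t (k - 1)`. -/
theorem representable_arith_iff (a d k n : ℕ) (hk : 0 < k) :
    Representable (fun j : Fin k => a + (j : ℕ) * d) n ↔
      ∃ t s, s ≤ t * (k - 1) ∧ n = t * a + s * d := by
  constructor
  · rintro ⟨x, rfl⟩
    refine ⟨∑ i, x i, ∑ i, x i * i, ?_, ?_⟩
    · rw [sum_mul]
      exact sum_le_sum fun i _ => Nat.mul_le_mul_left _ (by lia)
    · simp only [sum_mul, ← sum_add_distrib]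
      exact sum_congr rfl fun i _ => by ring
  · rintro ⟨t, s, hs, rfl⟩
    induction t generalizing s with
    | zero =>
      obtain rfl : s = 0 := by lia
      exact ⟨0, by simp⟩
    | succ t ih =>
      obtain ⟨x, hx⟩ := ih (s - min s (k - 1)) (by rw [add_one_mul] at hs; lia)
      refine ⟨x + Pi.single ⟨min s (k - 1), by lia⟩ 1, ?_⟩
      simp only [Pi.add_apply, add_mul, sum_add_distrib, ← hx]
      rw [sum_eq_single ⟨min s (k - 1), by lia⟩
        (fun b _ hb => by rw [Pi.single_eq_of_ne hb, zero_mul]) (by simp)]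
      rw [Pi.single_eq_same, one_mul, one_mul]
      dsimp only
      nth_rewrite 1 [show s = (s - min s (k - 1)) + min s (k - 1) by lia]
      ring

/-- The least number congruent to `r d` modulo `a` represented by `a, a + d, …, a + K d`. -/
def aperyElement (a d K r : ℕ) : ℕ := (r ⌈/⌉ K) * a + r * d

theorem representable_arith_iff_aperyElement_le (a d k n r : ℕ) (hk : 2 ≤ k)
    (hgcd : Nat.gcd a d = 1) (hr : r < a) (hn : n % a = r * d % a) :
    Representable (fun j : Fin k => a + (j : ℕ) * d) n ↔ aperyElement a d (k - 1) r ≤ n := by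
  have hK : 0 < k - 1 := by lia
  rw [representable_arith_iff a d k n (by lia), aperyElement]
  constructor
  · rintro ⟨t, s, hs, rfl⟩
    rw [Nat.mul_add_mod_self_right] at hn
    have hsr : s % a = r % a := Nat.ModEq.cancel_right_of_coprime hgcd hn
    rw [Nat.mod_eq_of_lt hr] at hsr
    have hle : r ≤ s := hsr ▸ Nat.mod_le s a
    have hc : r ⌈/⌉ (k - 1) ≤ t :=
      (ceilDiv_le_iff_le_mul hK).2 (by rw [mul_comm]; exact hle.trans hs)
    gcongr
  · intro hle
    have hmod : (aperyElement a d (k - 1) r) % a = n % a := by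
      rw [aperyElement, Nat.mul_add_mod_self_right, hn]
    obtain ⟨j, hj⟩ := (Nat.modEq_iff_dvd' hle).1 hmod
    refine ⟨r ⌈/⌉ (k - 1) + j, r, ?_, ?_⟩
    · have := (ceilDiv_le_iff_le_mul hK).1 (le_refl (r ⌈/⌉ (k - 1)))
      nlinarith
    · have : n = r ⌈/⌉ (k - 1) * a + r * d + a * j := by lia
      rw [this]
      ring

theorem mul_mod_injOn (a d : ℕ) (hgcd : Nat.gcd a d = 1) :
    Set.InjOn (fun r => r * d % a) (range a : Set ℕ) := by
  intro r hr s hs h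
  rw [mem_coe, mem_range] at hr hs
  exact (Nat.ModEq.cancel_right_of_coprime hgcd h).eq_of_lt_of_lt hr hs

theorem image_mul_mod_range (a d : ℕ) (ha : 0 < a) (hgcd : Nat.gcd a d = 1) :
    (range a).image (fun r => r * d % a) = range a := by
  apply eq_of_subset_of_card_le
  · intro x hx
    obtain ⟨r, -, rfl⟩ := mem_image.1 hx
    exact mem_range.2 (Nat.mod_lt _ ha)
  · rw [card_image_of_injOn (mul_mod_injOn a d hgcd)]

theorem aperyElement_mod (a d K r : ℕ) : aperyElement a d K r % a = r * d % a := by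
  rw [aperyElement, Nat.mul_add_mod_self_right]

theorem NRset_arith_eq_biUnion (a d k : ℕ) (ha : 0 < a) (hk : 2 ≤ k)
    (hgcd : Nat.gcd a d = 1) :
    NRset (fun j : Fin k => a + (j : ℕ) * d) =
      ((range a).biUnion fun r => {n ∈ range (aperyElement a d (k - 1) r) |
        n % a = aperyElement a d (k - 1) r % a} : Finset ℕ) := by
  ext n
  simp only [NRset, Set.mem_ofPred_eq, coe_biUnion, Set.mem_iUnion, mem_coe, mem_filter, mem_range,
    aperyElement_mod, exists_prop]
  constructor
  · rintro ⟨-, hn⟩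
    have : n % a ∈ (range a).image (fun r => r * d % a) := by
      rw [image_mul_mod_range a d ha hgcd]
      exact mem_range.2 (Nat.mod_lt _ ha)
    obtain ⟨r, hr, hrn⟩ := mem_image.1 this
    rw [mem_range] at hr
    rw [representable_arith_iff_aperyElement_le a d k n r hk hgcd hr hrn.symm, not_le] at hn
    exact ⟨r, hr, hn, hrn.symm⟩
  · rintro ⟨r, hr, hn, hrn⟩
    have hrep : ¬ Representable (fun j : Fin k => a + (j : ℕ) * d) n := by
      rwa [representable_arith_iff_aperyElement_le a d k n r hk hgcd hr hrn, not_le]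
    refine ⟨Nat.pos_of_ne_zero ?_, hrep⟩
    rintro rfl
    exact hrep ⟨0, by simp⟩

theorem finsum_NRset_arith (a d k : ℕ) (ha : 0 < a) (hk : 2 ≤ k)
    (hgcd : Nat.gcd a d = 1) (μ : ℕ) :
    ∑ᶠ n ∈ NRset (fun j : Fin k => a + (j : ℕ) * d), (n : ℚ) ^ μ =
      ∑ r ∈ range a, powerAntidifference a μ (aperyElement a d (k - 1) r) -
        bernoulli (μ + 1) / (μ + 1) := by
  rw [NRset_arith_eq_biUnion a d k ha hk hgcd, finsum_mem_coe_finset, sum_biUnion]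
  · rw [sum_congr rfl fun r _ => sum_filter_modEq_pow a ha μ (aperyElement a d (k - 1) r),
      sum_sub_distrib]
    simp only [aperyElement_mod]
    rw [← sum_powerAntidifference_range a ha μ]
    nth_rewrite 4 [← image_mul_mod_range a d ha hgcd]
    rw [sum_image (mul_mod_injOn a d hgcd)]
  · intro r hr s hs hrs
    rw [Function.onFun, disjoint_left]
    intro n hn hn'
    rw [mem_filter, aperyElement_mod] at hn hn'
    exact hrs (mul_mod_injOn a d hgcd hr hs (hn.2.symm.trans hn'.2))

/-- Abel summation for the ceilings `⌈r / K⌉`. -/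
theorem sum_ceilDiv_pow_mul_pow (a K : ℕ) (ha : 0 < a) (hK : 0 < K) (e l : ℕ) (hel : e + l ≠ 0) :
    ∑ r ∈ range a, ((r ⌈/⌉ K : ℕ) : ℚ) ^ e * (r : ℚ) ^ l =
      (((a - 1) / K : ℕ) + 1 : ℚ) ^ e * (∑ r ∈ range a, (r : ℚ) ^ l) -
        (∑ r ∈ range 1, (r : ℚ) ^ l) -
        ∑ i ∈ Icc 1 ((a - 1) / K), (((i : ℚ) + 1) ^ e - (i : ℚ) ^ e) *
          ∑ r ∈ range (i * K + 1), (r : ℚ) ^ l := by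
  set Q := (a - 1) / K with hQ
  have hinner : ∀ i ∈ Icc 1 Q, (((i : ℚ) + 1) ^ e - (i : ℚ) ^ e) *
      ∑ r ∈ range (i * K + 1), (r : ℚ) ^ l =
      ∑ r ∈ range a, if r ⌈/⌉ K ≤ i then (((i : ℚ) + 1) ^ e - (i : ℚ) ^ e) * (r : ℚ) ^ l
        else 0 := by
    intro i hi
    rw [mem_Icc] at hi
    have hia : i * K ≤ a - 1 := (Nat.le_div_iff_mul_le hK).1 hi.2
    rw [← sum_filter, mul_sum]
    refine sum_congr ?_ fun _ _ => rfl
    ext r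
    rw [mem_filter, mem_range, mem_range, ceilDiv_le_iff_le_mul hK, mul_comm K]
    lia
  have htel (c : ℕ) (hc : 1 ≤ c) (hcQ : c ≤ Q + 1) :
      ∑ i ∈ Icc 1 Q, (if c ≤ i then ((i : ℚ) + 1) ^ e - (i : ℚ) ^ e else 0) =
        ((Q : ℚ) + 1) ^ e - (c : ℚ) ^ e := by
    have hset : {i ∈ Icc 1 Q | c ≤ i} = Ico c (Q + 1) := by
      ext i
      simp only [mem_filter, mem_Icc, mem_Ico]
      lia
    rw [← sum_filter, hset]
    have := sum_Ico_sub (fun i : ℕ => (i : ℚ) ^ e) hcQ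
    push_cast at this
    exact this
  rw [sum_congr rfl hinner, sum_comm, mul_sum, sub_right_comm, ← sum_sub_distrib]
  obtain ⟨b, rfl⟩ := Nat.exists_eq_add_of_le' ha
  rw [sum_range_succ', sum_range_succ' _ b, sum_range_one]
  have hz : (0 : ℚ) ^ e * (0 : ℚ) ^ l = 0 := by
    rw [← pow_add, zero_pow hel]
  have hfactor (r : ℕ) : ∑ i ∈ Icc 1 Q, (if r ⌈/⌉ K ≤ i then
      (((i : ℚ) + 1) ^ e - (i : ℚ) ^ e) * (r : ℚ) ^ l else 0) =
      (∑ i ∈ Icc 1 Q, (if r ⌈/⌉ K ≤ i then ((i : ℚ) + 1) ^ e - (i : ℚ) ^ e else 0)) *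
        (r : ℚ) ^ l := by
    simp only [sum_mul, ite_mul, zero_mul]
  have hzero : ∑ i ∈ Icc 1 Q, (if 0 ≤ i then ((i : ℚ) + 1) ^ e - (i : ℚ) ^ e else 0) =
      ((Q : ℚ) + 1) ^ e - 1 := by
    have := htel 1 le_rfl (by lia)
    rw [Nat.cast_one, one_pow] at this
    rw [← this]
    refine sum_congr rfl fun i hi => ?_
    rw [if_pos (Nat.zero_le i), if_pos (mem_Icc.1 hi).1]
  rw [hfactor 0, zero_ceilDiv, hzero, Nat.cast_zero, hz, add_zero]
  have hmain : ∀ r ∈ range b, ((Q : ℚ) + 1) ^ e * ((r + 1 : ℕ) : ℚ) ^ l -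
      ∑ i ∈ Icc 1 Q, (if (r + 1) ⌈/⌉ K ≤ i then
        (((i : ℚ) + 1) ^ e - (i : ℚ) ^ e) * ((r + 1 : ℕ) : ℚ) ^ l else 0) =
      (((r + 1) ⌈/⌉ K : ℕ) : ℚ) ^ e * ((r + 1 : ℕ) : ℚ) ^ l := by
    intro r hr
    rw [mem_range] at hr
    have h1 : 1 ≤ (r + 1) ⌈/⌉ K := by
      by_contra! h
      have := (ceilDiv_le_iff_le_mul hK).1 (Nat.lt_one_iff.1 h).le
      lia
    have h2 : (r + 1) ⌈/⌉ K ≤ Q + 1 := by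
      rw [ceilDiv_le_iff_le_mul hK]
      have := Nat.lt_mul_div_succ b hK
      rw [Nat.add_sub_cancel] at hQ
      rw [hQ]
      lia
    rw [hfactor, htel _ h1 h2]
    ring
  rw [sum_congr rfl hmain]
  ring

/-- Faulhaber's formula substituted into `sum_ceilDiv_pow_mul_pow`. -/
theorem sum_ceilDiv_pow_mul_pow_eq_bernoulli (a K : ℕ) (ha : 0 < a) (hK : 0 < K) (e l : ℕ)
    (hel : e + l ≠ 0) :
    ∑ r ∈ range a, ((r ⌈/⌉ K : ℕ) : ℚ) ^ e * (r : ℚ) ^ l =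
      ∑ j ∈ range (l + 1), ((l + 1).choose j : ℚ) * (bernoulli j / ((l : ℚ) + 1)) *
        ((((a - 1) / K : ℕ) + 1 : ℚ) ^ e * (a : ℚ) ^ (l + 1 - j) - 1 -
          ∑ i ∈ Icc 1 ((a - 1) / K), (((i : ℚ) + 1) ^ e - (i : ℚ) ^ e) *
            ((i * K + 1 : ℕ) : ℚ) ^ (l + 1 - j)) := by
  rw [sum_ceilDiv_pow_mul_pow a K ha hK e l hel]
  simp only [sum_range_pow, mul_sub, sum_sub_distrib, mul_sum]
  congr 1
  · congr 1
    · exact sum_congr rfl fun j _ => by ring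
    · exact sum_congr rfl fun j _ => by rw [Nat.cast_one, one_pow]; ring
  · rw [sum_comm]
    exact sum_congr rfl fun j _ => sum_congr rfl fun i _ => by ring

theorem sum_aperyElement_pow (a d K : ℕ) (ha : 0 < a) (hK : 0 < K) (p : ℕ) (hp : p ≠ 0) :
    ∑ r ∈ range a, (aperyElement a d K r : ℚ) ^ p =
      ∑ l ∈ range (p + 1), ∑ j ∈ range (l + 1), (p.choose l : ℚ) * (a : ℚ) ^ (p - l) *
        (d : ℚ) ^ l * (((l + 1).choose j : ℚ) * (bernoulli j / ((l : ℚ) + 1)) *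
        ((((a - 1) / K : ℕ) + 1 : ℚ) ^ (p - l) * (a : ℚ) ^ (l + 1 - j) - 1 -
          ∑ i ∈ Icc 1 ((a - 1) / K), (((i : ℚ) + 1) ^ (p - l) - (i : ℚ) ^ (p - l)) *
            ((i * K + 1 : ℕ) : ℚ) ^ (l + 1 - j))) := by
  have hexpand (r : ℕ) : (aperyElement a d K r : ℚ) ^ p = ∑ l ∈ range (p + 1),
      (p.choose l : ℚ) * (a : ℚ) ^ (p - l) * (d : ℚ) ^ l *
        (((r ⌈/⌉ K : ℕ) : ℚ) ^ (p - l) * (r : ℚ) ^ l) := by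
    rw [aperyElement]
    push_cast
    rw [add_comm, add_pow]
    refine sum_congr rfl fun l _ => ?_
    rw [mul_pow, mul_pow]
    ring
  simp only [hexpand]
  rw [sum_comm]
  refine sum_congr rfl fun l hl => ?_
  rw [mem_range] at hl
  rw [← mul_sum, sum_ceilDiv_pow_mul_pow_eq_bernoulli a K ha hK (p - l) l (by lia), mul_sum]

/-- Explicit formula for the Sylvester power sum of an arithmetic sequence
`a, a+d, …, a+(k−1)d`. -/
theorem stmt6 (a d k : ℕ) (ha : 0 < a) (hd : 0 < d)
    (hk : 2 ≤ k) (hka : k ≤ a) (hgcd : Nat.gcd a d = 1)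
    (μ : ℕ) :
    ∑ᶠ n ∈ NRset (fun j : Fin k => a + (j : ℕ) * d), (n : ℚ) ^ μ =
      (1 / ((μ : ℚ) + 1)) * ∑ κ ∈ Finset.range (μ + 1),
        ∑ l ∈ Finset.range (μ + 1 - κ + 1), ∑ j ∈ Finset.range (l + 1),
          ((μ + 1).choose κ : ℚ) * ((μ + 1 - κ).choose l : ℚ) *
            ((l + 1).choose j : ℚ) *
            (bernoulli κ * bernoulli j * (a : ℚ) ^ ((μ : ℤ) - (l : ℤ)) * (d : ℚ) ^ l
              / ((l : ℚ) + 1)) *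
            ( (((a - 1) / (k - 1) : ℕ) + 1 : ℚ) ^ (μ + 1 - κ - l) *
                (a : ℚ) ^ (l + 1 - j) - 1
              - ∑ i ∈ Finset.Icc 1 ((a - 1) / (k - 1)),
                  (((i : ℚ) + 1) ^ (μ + 1 - κ - l) - (i : ℚ) ^ (μ + 1 - κ - l)) *
                    ((i * (k - 1) + 1 : ℕ) : ℚ) ^ (l + 1 - j) )
        + bernoulli (μ + 1) / ((μ : ℚ) + 1) * ((a : ℚ) ^ (μ + 1) - 1) := by
  have ha' : (a : ℚ) ≠ 0 := by positivity
  rw [finsum_NRset_arith a d k ha hk hgcd μ]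
  simp only [powerAntidifference_eq_sum a ha μ]
  rw [sum_add_distrib, ← mul_sum, sum_comm, sum_const, card_range, nsmul_eq_mul]
  simp only [← mul_sum]
  rw [add_sub_assoc]
  congr 1
  · congr 1
    refine sum_congr rfl fun κ hκ => ?_
    rw [mem_range] at hκ
    rw [sum_aperyElement_pow a d (k - 1) ha (by lia) (μ + 1 - κ) (by lia), mul_sum]
    refine sum_congr rfl fun l hl => ?_
    rw [mem_range] at hl
    rw [mul_sum]
    refine sum_congr rfl fun j _ => ?_
    have hpow : (a : ℚ) ^ ((μ : ℤ) - (l : ℤ)) =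
        (a : ℚ) ^ ((κ : ℤ) - 1) * (a : ℚ) ^ (μ + 1 - κ - l) := by
      rw [← zpow_natCast, ← zpow_add₀ ha']
      congr 1
      lia
    rw [hpow]
    ring
  · ring
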